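/- arXiv:2603.09814 — 2 statements merged into one kernel-verified Lean document; each statement's English description precedes it below -/
import Mathlib

section
/- Consider problem (P-u) with θ̃ and φ̃ additionally restricted to lie in the range of Cᵀ. Then any two global minimizers of this restricted problem coincide; i.e., the restricted problem admits at most one global minimizer. -/
open Matrix

/-- Objective of problem (P-u): `F(u) + (1/2) ωᵀ D ω`. -/
noncomputable def objPu {n : ℕ} (d : Fin n → ℝ) (F : Fin n → ℝ → ℝ) (ω u : Fin n → ℝ) : ℝ :=
  (∑ i, F i (u i)) + (1 / 2) * (ω ⬝ᵥ (Matrix.diagonal d *ᵥ ω))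

/-- Feasibility for problem (P-u): `u − p − Dω − CBθ̃ = 0` and `u − p − CBφ̃ = 0`. -/
def feasPu {n m : ℕ} (C : Matrix (Fin n) (Fin m) ℝ) (b : Fin m → ℝ) (d : Fin n → ℝ)
    (p : Fin n → ℝ) (θ : Fin m → ℝ) (ω u : Fin n → ℝ) (φ : Fin m → ℝ) : Prop :=
  (∀ i, u i - p i - (Matrix.diagonal d *ᵥ ω) i - ((C * Matrix.diagonal b) *ᵥ θ) i = 0) ∧
  (∀ i, u i - p i - ((C * Matrix.diagonal b) *ᵥ φ) i = 0)

/-- `θ` lies in the range of `Cᵀ`. -/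
def inRangeCT {n m : ℕ} (C : Matrix (Fin n) (Fin m) ℝ) (θ : Fin m → ℝ) : Prop :=
  ∃ x : Fin n → ℝ, Cᵀ *ᵥ x = θ

/-- Global minimizer of the restricted problem (P-u), where `θ̃` and `φ̃` are restricted
to the range of `Cᵀ`. -/
def isMinPuR {n m : ℕ} (C : Matrix (Fin n) (Fin m) ℝ) (b : Fin m → ℝ) (d : Fin n → ℝ)
    (p : Fin n → ℝ) (F : Fin n → ℝ → ℝ)
    (θ : Fin m → ℝ) (ω u : Fin n → ℝ) (φ : Fin m → ℝ) : Prop :=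
  feasPu C b d p θ ω u φ ∧ inRangeCT C θ ∧ inRangeCT C φ ∧
  ∀ θ' : Fin m → ℝ, ∀ ω' u' : Fin n → ℝ, ∀ φ' : Fin m → ℝ,
    feasPu C b d p θ' ω' u' φ' → inRangeCT C θ' → inRangeCT C φ' →
      objPu d F ω u ≤ objPu d F ω' u'

/-- For positive weights `b`, the map `C diag(b)` is injective on the range of `Cᵀ`. -/
theorem inRangeCT.eq_of_mulVec_eq {n m : ℕ} {C : Matrix (Fin n) (Fin m) ℝ} {b : Fin m → ℝ}
    (hb : ∀ i, 0 < b i) {θ₁ θ₂ : Fin m → ℝ} (h₁ : inRangeCT C θ₁) (h₂ : inRangeCT C θ₂)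
    (h : (C * Matrix.diagonal b) *ᵥ θ₁ = (C * Matrix.diagonal b) *ᵥ θ₂) : θ₁ = θ₂ := by
  obtain ⟨x₁, rfl⟩ := h₁
  obtain ⟨x₂, rfl⟩ := h₂
  set v := Cᵀ *ᵥ (x₁ - x₂) with hv
  have h0 : C *ᵥ (Matrix.diagonal b *ᵥ v) = 0 := by
    rw [hv, Matrix.mulVec_mulVec, Matrix.mulVec_sub, Matrix.mulVec_sub, h, sub_self]
  have hq : v ⬝ᵥ (Matrix.diagonal b *ᵥ v) = 0 := by
    nth_rewrite 1 [hv]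
    rw [Matrix.mulVec_transpose, ← Matrix.dotProduct_mulVec, h0, dotProduct_zero]
  have hterm : ∀ i, v i * (b i * v i) = b i * v i ^ 2 := fun i => by ring
  simp only [dotProduct, Matrix.mulVec_diagonal, hterm] at hq
  rw [Finset.sum_eq_zero_iff_of_nonneg fun i _ => mul_nonneg (hb i).le (sq_nonneg _)] at hq
  have hv0 : v = 0 := by
    ext i
    simpa [(hb i).ne'] using hq i (Finset.mem_univ i)
  rwa [hv, Matrix.mulVec_sub, sub_eq_zero] at hv0

theorem inRangeCT.midpoint {n m : ℕ} {C : Matrix (Fin n) (Fin m) ℝ} {θ₁ θ₂ : Fin m → ℝ}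
    (h₁ : inRangeCT C θ₁) (h₂ : inRangeCT C θ₂) : inRangeCT C ((1 / 2 : ℝ) • (θ₁ + θ₂)) := by
  obtain ⟨x₁, rfl⟩ := h₁
  obtain ⟨x₂, rfl⟩ := h₂
  exact ⟨(1 / 2 : ℝ) • (x₁ + x₂), by rw [Matrix.mulVec_smul, Matrix.mulVec_add]⟩

theorem feasPu.midpoint {n m : ℕ} {C : Matrix (Fin n) (Fin m) ℝ} {b : Fin m → ℝ}
    {d p : Fin n → ℝ} {θ₁ θ₂ φ₁ φ₂ : Fin m → ℝ} {ω₁ ω₂ u₁ u₂ : Fin n → ℝ}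
    (h₁ : feasPu C b d p θ₁ ω₁ u₁ φ₁) (h₂ : feasPu C b d p θ₂ ω₂ u₂ φ₂) :
    feasPu C b d p ((1 / 2 : ℝ) • (θ₁ + θ₂)) ((1 / 2 : ℝ) • (ω₁ + ω₂))
      ((1 / 2 : ℝ) • (u₁ + u₂)) ((1 / 2 : ℝ) • (φ₁ + φ₂)) := by
  refine ⟨fun i => ?_, fun i => ?_⟩ <;>
    simp only [Matrix.mulVec_smul, Matrix.mulVec_add, Pi.smul_apply, Pi.add_apply, smul_eq_mul]
  · linear_combination (1 / 2 : ℝ) * h₁.1 i + (1 / 2 : ℝ) * h₂.1 i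
  · linear_combination (1 / 2 : ℝ) * h₁.2 i + (1 / 2 : ℝ) * h₂.2 i

theorem objPu_eq_sum {n : ℕ} (d : Fin n → ℝ) (F : Fin n → ℝ → ℝ) (ω u : Fin n → ℝ) :
    objPu d F ω u = ∑ i, (F i (u i) + 1 / 2 * (d i * ω i ^ 2)) := by
  simp only [objPu, dotProduct, Matrix.mulVec_diagonal, Finset.sum_add_distrib, Finset.mul_sum]
  congr 1
  exact Finset.sum_congr rfl fun i _ => by ring

/-- Strict midpoint convexity of the objective, jointly in `ω` and `u`. -/
theorem objPu_midpoint_lt {n : ℕ} {d : Fin n → ℝ} (hd : ∀ i, 0 < d i) {F : Fin n → ℝ → ℝ}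
    (hF : ∀ i, StrictConvexOn ℝ Set.univ (F i)) {ω₁ ω₂ u₁ u₂ : Fin n → ℝ}
    (hne : ¬(ω₁ = ω₂ ∧ u₁ = u₂)) :
    objPu d F ((1 / 2 : ℝ) • (ω₁ + ω₂)) ((1 / 2 : ℝ) • (u₁ + u₂)) <
      1 / 2 * (objPu d F ω₁ u₁ + objPu d F ω₂ u₂) := by
  have hFle : ∀ i, F i (1 / 2 * (u₁ i + u₂ i)) ≤ 1 / 2 * (F i (u₁ i) + F i (u₂ i)) := by
    intro i
    have := (hF i).convexOn.2 (Set.mem_univ (u₁ i)) (Set.mem_univ (u₂ i))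
      (show (0 : ℝ) ≤ 1 / 2 by norm_num) (show (0 : ℝ) ≤ 1 / 2 by norm_num) (by norm_num)
    simpa only [smul_eq_mul, ← mul_add] using this
  have hFlt : ∀ i, u₁ i ≠ u₂ i →
      F i (1 / 2 * (u₁ i + u₂ i)) < 1 / 2 * (F i (u₁ i) + F i (u₂ i)) := by
    intro i hi
    have := (hF i).2 (Set.mem_univ (u₁ i)) (Set.mem_univ (u₂ i)) hi
      (show (0 : ℝ) < 1 / 2 by norm_num) (show (0 : ℝ) < 1 / 2 by norm_num) (by norm_num)
    simpa only [smul_eq_mul, ← mul_add] using this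
  have hgap : ∀ i, d i * (1 / 2 * (ω₁ i + ω₂ i)) ^ 2 =
      1 / 2 * (d i * ω₁ i ^ 2 + d i * ω₂ i ^ 2) - 1 / 4 * (d i * (ω₁ i - ω₂ i) ^ 2) :=
    fun i => by ring
  simp only [objPu_eq_sum, ← Finset.sum_add_distrib, Finset.mul_sum, Pi.smul_apply, Pi.add_apply,
    smul_eq_mul, hgap]
  refine Finset.sum_lt_sum (fun i _ => ?_) ?_
  · linarith [hFle i, mul_nonneg (hd i).le (sq_nonneg (ω₁ i - ω₂ i))]
  · have hex : ∃ i, ω₁ i ≠ ω₂ i ∨ u₁ i ≠ u₂ i := by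
      by_contra! hcon
      exact hne ⟨funext fun i => (hcon i).1, funext fun i => (hcon i).2⟩
    obtain ⟨i, hω | hu⟩ := hex
    · have : 0 < d i * (ω₁ i - ω₂ i) ^ 2 :=
        mul_pos (hd i) (sq_pos_of_ne_zero (sub_ne_zero.2 hω))
      exact ⟨i, Finset.mem_univ i, by linarith [hFle i]⟩
    · exact ⟨i, Finset.mem_univ i, by
        linarith [hFlt i hu, mul_nonneg (hd i).le (sq_nonneg (ω₁ i - ω₂ i))]⟩

/-- The restricted problem (P-u) admits at most one global minimizer. -/
theorem restricted_Pu_minimizer_unique {n m : ℕ}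
    (C : Matrix (Fin n) (Fin m) ℝ)
    (b : Fin m → ℝ) (hb : ∀ i, 0 < b i)
    (d : Fin n → ℝ) (hd : ∀ i, 0 < d i)
    (p : Fin n → ℝ)
    (F : Fin n → ℝ → ℝ)
    (hFconv : ∀ i, StrictConvexOn ℝ Set.univ (F i))
    (hFdiff : ∀ i, Differentiable ℝ (F i))
    (θ₁ : Fin m → ℝ) (ω₁ u₁ : Fin n → ℝ) (φ₁ : Fin m → ℝ)
    (θ₂ : Fin m → ℝ) (ω₂ u₂ : Fin n → ℝ) (φ₂ : Fin m → ℝ)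
    (h₁ : isMinPuR C b d p F θ₁ ω₁ u₁ φ₁)
    (h₂ : isMinPuR C b d p F θ₂ ω₂ u₂ φ₂) :
    θ₁ = θ₂ ∧ ω₁ = ω₂ ∧ u₁ = u₂ ∧ φ₁ = φ₂ := by
  obtain ⟨hf₁, hθ₁, hφ₁, hmin₁⟩ := h₁
  obtain ⟨hf₂, hθ₂, hφ₂, hmin₂⟩ := h₂
  have hωu : ω₁ = ω₂ ∧ u₁ = u₂ := by
    by_contra hne
    have hlt := objPu_midpoint_lt hd hFconv hne
    have hle₁ := hmin₁ _ _ _ _ (hf₁.midpoint hf₂) (hθ₁.midpoint hθ₂) (hφ₁.midpoint hφ₂)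
    have hle₂ := hmin₂ _ _ _ _ (hf₁.midpoint hf₂) (hθ₁.midpoint hθ₂) (hφ₁.midpoint hφ₂)
    linarith
  obtain ⟨rfl, rfl⟩ := hωu
  refine ⟨hθ₁.eq_of_mulVec_eq hb hθ₂ (funext fun i => ?_), rfl, rfl,
    hφ₁.eq_of_mulVec_eq hb hφ₂ (funext fun i => ?_)⟩
  · linarith [hf₁.1 i, hf₂.1 i]
  · linarith [hf₁.2 i, hf₂.2 i]
end

section
/- Consider problems (P-u) and (OPT-SS), each with the angle variables (θ̃ and φ̃ in (P-u); θ̃ in (OPT-SS)) restricted to lie in the range of Cᵀ. A point (θ̃*, ω*, u*, φ̃*) is a global minimizer of the restricted problem (P-u) if and only if θ̃* = φ̃*, ω* = 0, and (θ̃*, 0, u*) is a global minimizer of the restricted problem (OPT-SS). -/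
open Matrix

/-- Feasibility for problem (OPT-SS): `u − p − Dω − CBθ̃ = 0` and `u − p − CBθ̃ = 0`. -/
def feasOptSS {n m : ℕ} (C : Matrix (Fin n) (Fin m) ℝ) (b : Fin m → ℝ) (d : Fin n → ℝ)
    (p : Fin n → ℝ) (θ : Fin m → ℝ) (ω u : Fin n → ℝ) : Prop :=
  (∀ i, u i - p i - (Matrix.diagonal d *ᵥ ω) i - ((C * Matrix.diagonal b) *ᵥ θ) i = 0) ∧
  (∀ i, u i - p i - ((C * Matrix.diagonal b) *ᵥ θ) i = 0)

/-- Global minimizer of the restricted problem (OPT-SS). -/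
def isMinOptSSR {n m : ℕ} (C : Matrix (Fin n) (Fin m) ℝ) (b : Fin m → ℝ) (d : Fin n → ℝ)
    (p : Fin n → ℝ) (F : Fin n → ℝ → ℝ)
    (θ : Fin m → ℝ) (ω u : Fin n → ℝ) : Prop :=
  feasOptSS C b d p θ ω u ∧ inRangeCT C θ ∧
  ∀ θ' : Fin m → ℝ, ∀ ω' u' : Fin n → ℝ,
    feasOptSS C b d p θ' ω' u' → inRangeCT C θ' →
      (∑ i, F i (u i)) ≤ (∑ i, F i (u' i))

theorem dotProduct_diagonal_mulVec_self {k : ℕ} (w x : Fin k → ℝ) :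
    x ⬝ᵥ (Matrix.diagonal w *ᵥ x) = ∑ i, w i * x i ^ 2 := by
  simp only [dotProduct, Matrix.mulVec_diagonal]
  exact Finset.sum_congr rfl fun i _ => by ring

theorem dotProduct_diagonal_mulVec_self_nonneg {k : ℕ} {w : Fin k → ℝ} (hw : ∀ i, 0 < w i)
    (x : Fin k → ℝ) : 0 ≤ x ⬝ᵥ (Matrix.diagonal w *ᵥ x) := by
  rw [dotProduct_diagonal_mulVec_self]
  exact Finset.sum_nonneg fun i _ => mul_nonneg (hw i).le (sq_nonneg _)

theorem eq_zero_of_dotProduct_diagonal_mulVec_self_nonpos {k : ℕ} {w : Fin k → ℝ}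
    (hw : ∀ i, 0 < w i) {x : Fin k → ℝ} (h : x ⬝ᵥ (Matrix.diagonal w *ᵥ x) ≤ 0) : x = 0 := by
  have h0 := le_antisymm h (dotProduct_diagonal_mulVec_self_nonneg hw x)
  rw [dotProduct_diagonal_mulVec_self, Finset.sum_eq_zero_iff_of_nonneg
    fun i _ => mul_nonneg (hw i).le (sq_nonneg _)] at h0
  funext i
  simpa [(hw i).ne'] using h0 i (Finset.mem_univ i)

/-- `C B` is injective on the range of `Cᵀ`. -/
theorem eq_of_inRangeCT_of_mulVec_eq {n m : ℕ} {C : Matrix (Fin n) (Fin m) ℝ} {b : Fin m → ℝ}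
    (hb : ∀ i, 0 < b i) {θ φ : Fin m → ℝ} (hθ : inRangeCT C θ) (hφ : inRangeCT C φ)
    (h : (C * Matrix.diagonal b) *ᵥ θ = (C * Matrix.diagonal b) *ᵥ φ) : θ = φ := by
  obtain ⟨x, rfl⟩ := hθ
  obtain ⟨y, rfl⟩ := hφ
  rw [← sub_eq_zero, ← Matrix.mulVec_sub] at h ⊢
  apply eq_zero_of_dotProduct_diagonal_mulVec_self_nonpos hb
  rw [← Matrix.mulVec_sub, ← Matrix.mulVec_mulVec] at h
  nth_rw 1 [Matrix.mulVec_transpose]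
  rw [← Matrix.dotProduct_mulVec, h, dotProduct_zero]

theorem objPu_zero {n : ℕ} (d : Fin n → ℝ) (F : Fin n → ℝ → ℝ) (u : Fin n → ℝ) :
    objPu d F 0 u = ∑ i, F i (u i) := by
  simp [objPu]

theorem sum_le_objPu {n : ℕ} {d : Fin n → ℝ} (hd : ∀ i, 0 < d i) (F : Fin n → ℝ → ℝ)
    (ω u : Fin n → ℝ) : ∑ i, F i (u i) ≤ objPu d F ω u := by
  have := dotProduct_diagonal_mulVec_self_nonneg hd ω
  unfold objPu
  linarith

/-- The second constraint alone makes `(φ, 0, u)` feasible for (OPT-SS). -/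
theorem feasPu.feasOptSS_zero {n m : ℕ} {C : Matrix (Fin n) (Fin m) ℝ} {b : Fin m → ℝ}
    {d p : Fin n → ℝ} {θ φ : Fin m → ℝ} {ω u : Fin n → ℝ} (h : feasPu C b d p θ ω u φ) :
    feasOptSS C b d p φ 0 u :=
  ⟨fun i => by simpa using h.2 i, h.2⟩

theorem feasOptSS.eq_zero {n m : ℕ} {C : Matrix (Fin n) (Fin m) ℝ} {b : Fin m → ℝ}
    {d p : Fin n → ℝ} (hd : ∀ i, 0 < d i) {θ : Fin m → ℝ} {ω u : Fin n → ℝ}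
    (h : feasOptSS C b d p θ ω u) : ω = 0 := by
  funext i
  have h1 := h.1 i
  have h2 := h.2 i
  rw [Matrix.mulVec_diagonal] at h1
  have h3 : d i * ω i = 0 := by linarith
  exact (mul_eq_zero.mp h3).resolve_left (hd i).ne'

/-- `(θ̃*, ω*, u*, φ̃*)` minimizes the restricted (P-u) iff
`θ̃* = φ̃*`, `ω* = 0`, and `(θ̃*, 0, u*)` minimizes the restricted (OPT-SS). -/
theorem restricted_Pu_iff_restricted_OptSS {n m : ℕ}
    (C : Matrix (Fin n) (Fin m) ℝ)
    (b : Fin m → ℝ) (hb : ∀ i, 0 < b i)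
    (d : Fin n → ℝ) (hd : ∀ i, 0 < d i)
    (p : Fin n → ℝ)
    (F : Fin n → ℝ → ℝ)
    (hFconv : ∀ i, StrictConvexOn ℝ Set.univ (F i))
    (hFdiff : ∀ i, Differentiable ℝ (F i))
    (θs : Fin m → ℝ) (ωs us : Fin n → ℝ) (φs : Fin m → ℝ) :
    isMinPuR C b d p F θs ωs us φs ↔
      (θs = φs ∧ ωs = 0 ∧ isMinOptSSR C b d p F θs 0 us) := by
  constructor
  · rintro ⟨hfeas, hθ, hφ, hmin⟩
    have hω : ωs = 0 := by
      have h := hmin φs 0 us φs hfeas.feasOptSS_zero hφ hφ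
      rw [objPu_zero, objPu] at h
      exact eq_zero_of_dotProduct_diagonal_mulVec_self_nonpos hd (by linarith)
    subst hω
    have hθφ : θs = φs := by
      refine eq_of_inRangeCT_of_mulVec_eq hb hθ hφ (funext fun i => ?_)
      have h1 := hfeas.1 i
      have h2 := hfeas.2 i
      rw [Matrix.mulVec_zero, Pi.zero_apply] at h1
      linarith
    subst hθφ
    refine ⟨rfl, rfl, hfeas, hθ, fun θ' ω' u' h' hθ' => ?_⟩
    have hω' := h'.eq_zero hd
    subst hω'
    simpa only [objPu_zero] using hmin θ' 0 u' θ' h' hθ' hθ'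
  · rintro ⟨rfl, rfl, hfeas, hθ, hmin⟩
    refine ⟨hfeas, hθ, hθ, fun θ' ω' u' φ' h' _ hφ' => ?_⟩
    rw [objPu_zero]
    exact (hmin φ' 0 u' h'.feasOptSS_zero hφ').trans (sum_le_objPu hd F ω' u')
end
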